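/- arXiv:1810.07949 — 2 statements merged into one kernel-verified Lean document; each statement's English description precedes it below -/
import Mathlib

section
/- Let U be a finite set, let P_1, …, P_m be a partition of U (pairwise disjoint subsets whose union is U), and let r : U → ℝ satisfy r(s) ≥ 0 for all s ∈ U. Then the diversity function f_Div defined on subsets S ⊆ U by f_Div(S) = Σ_{i=1}^{m} √(Σ_{s ∈ P_i ∩ S} r(s)) is monotone and submodular. -/
/-- The square root has diminishing increments. -/
theorem Real.sqrt_add_sub_sqrt_le {a b c : ℝ} (ha : 0 ≤ a) (hab : a ≤ b) (hc : 0 ≤ c) :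
    √(b + c) - √b ≤ √(a + c) - √a := by
  have hsa := Real.sq_sqrt ha
  have hsb := Real.sq_sqrt (ha.trans hab)
  have hsac := Real.sq_sqrt (add_nonneg ha hc)
  have hsbc := Real.sq_sqrt (add_nonneg (ha.trans hab) hc)
  have hle : √a ≤ √b := Real.sqrt_le_sqrt hab
  have hle' : √(a + c) ≤ √(b + c) := Real.sqrt_le_sqrt (by linarith)
  have hinc : √a ≤ √(a + c) := Real.sqrt_le_sqrt (by linarith)
  have hb := Real.sqrt_nonneg b
  by_contra! h
  have hpos : 0 < √(b + c) + √b := by linarith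
  have hlt := mul_lt_mul_of_pos_right h hpos
  have hmono : (√(a + c) - √a) * (√(a + c) + √a) ≤ (√(a + c) - √a) * (√(b + c) + √b) :=
    mul_le_mul_of_nonneg_left (by linarith) (by linarith)
  linarith

/-- The diversity function
`f_Div(S) = ∑_i √(∑_{s ∈ P_i ∩ S} r(s))` for a partition `P_1, …, P_m` of `U`
and nonnegative `r` is monotone and submodular. -/
theorem diversity_monotone_submodular {U : Type*} [Fintype U] [DecidableEq U]
    (m : ℕ) (P : Fin m → Finset U)
    (hdisj : ∀ i j : Fin m, i ≠ j → Disjoint (P i) (P j))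
    (hcover : Finset.univ.biUnion P = Finset.univ)
    (r : U → ℝ) (hr : ∀ s : U, 0 ≤ r s) :
    (∀ A B : Finset U, A ⊆ B →
      (∑ i : Fin m, Real.sqrt (∑ s ∈ P i ∩ A, r s)) ≤
        (∑ i : Fin m, Real.sqrt (∑ s ∈ P i ∩ B, r s))) ∧
    (∀ A B : Finset U, A ⊆ B → ∀ v : U, v ∉ B →
      (∑ i : Fin m, Real.sqrt (∑ s ∈ P i ∩ insert v B, r s)) -
        (∑ i : Fin m, Real.sqrt (∑ s ∈ P i ∩ B, r s)) ≤
      (∑ i : Fin m, Real.sqrt (∑ s ∈ P i ∩ insert v A, r s)) -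
        (∑ i : Fin m, Real.sqrt (∑ s ∈ P i ∩ A, r s))) := by
  have hmono : ∀ {A B : Finset U}, A ⊆ B → ∀ i,
      ∑ s ∈ P i ∩ A, r s ≤ ∑ s ∈ P i ∩ B, r s := fun hAB i =>
    Finset.sum_le_sum_of_subset_of_nonneg (Finset.inter_subset_inter_left hAB)
      fun s _ _ => hr s
  refine ⟨fun A B hAB => Finset.sum_le_sum fun i _ => Real.sqrt_le_sqrt (hmono hAB i),
    fun A B hAB v hvB => ?_⟩
  rw [← Finset.sum_sub_distrib, ← Finset.sum_sub_distrib]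
  refine Finset.sum_le_sum fun i _ => ?_
  by_cases hv : v ∈ P i
  · have hsum : ∀ {S : Finset U}, v ∉ S →
        ∑ s ∈ P i ∩ insert v S, r s = ∑ s ∈ P i ∩ S, r s + r v := fun {S} hvS => by
      rw [Finset.inter_insert_of_mem hv,
        Finset.sum_insert fun h => hvS (Finset.mem_inter.mp h).2, add_comm]
    rw [hsum hvB, hsum fun h => hvB (hAB h)]
    exact Real.sqrt_add_sub_sqrt_le (Finset.sum_nonneg fun s _ => hr s) (hmono hAB i) (hr v)
  · simp [Finset.inter_insert_of_notMem hv]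
end

section
/- Let U be a finite set, D a set, d : U → D, and ℓ, k ∈ ℕ with ℓ ≥ 1 and k ≥ 1. Let 𝓘 = {S ⊆ U : |d(S)| ≤ ℓ and for every a ∈ D, |{s ∈ S : d(s) = a}| ≤ k}. Then 𝓘 is a k-independence system (k-system): for every X ⊆ U and every two sets S, T ⊆ X that are maximal elements (with respect to inclusion) of {A ⊆ X : A ∈ 𝓘}, one has |S| ≤ k · |T|. -/
/-- The timeline summarization constraints: a summary `S` has at most `ℓ`
distinct dates, and at most `k` sentences for each date. -/
def timelineConstraint {U D : Type*} [DecidableEq U] [DecidableEq D]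
    (d : U → D) (ℓ k : ℕ) (S : Finset U) : Prop :=
  (S.image d).card ≤ ℓ ∧ ∀ a : D, (S.filter fun s => d s = a).card ≤ k

/-- A feasible set with a spare date and a spare place at the date of `x` stays feasible
after inserting `x`. -/
theorem timelineConstraint.insert {U D : Type*} [DecidableEq U] [DecidableEq D]
    {d : U → D} {ℓ k : ℕ} {T : Finset U} {x : U} (hT : timelineConstraint d ℓ k T)
    (hdates : (T.image d).card < ℓ) (hx : (T.filter fun s => d s = d x).card < k) :
    timelineConstraint d ℓ k (insert x T) := by
  refine ⟨?_, fun a => ?_⟩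
  · rw [Finset.image_insert]
    exact (Finset.card_insert_le _ _).trans hdates
  · rw [Finset.filter_insert]
    split_ifs with h
    · subst h
      exact (Finset.card_insert_le _ _).trans hx
    · exact hT.2 a

/-- The timeline constraints form a `k`-independence system:
for every ground subset `X`, any two inclusion-maximal feasible subsets of
`X` have sizes within a factor of `k`. -/
theorem timelineConstraint_kSystem {U D : Type*} [Fintype U] [DecidableEq U]
    [DecidableEq D] (d : U → D) (ℓ k : ℕ) (hℓ : 1 ≤ ℓ) (hk : 1 ≤ k) :
    ∀ X S T : Finset U,
      (S ⊆ X ∧ timelineConstraint d ℓ k S ∧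
        ∀ A : Finset U, A ⊆ X → timelineConstraint d ℓ k A → S ⊆ A → A = S) →
      (T ⊆ X ∧ timelineConstraint d ℓ k T ∧
        ∀ A : Finset U, A ⊆ X → timelineConstraint d ℓ k A → T ⊆ A → A = T) →
      S.card ≤ k * T.card := by
  rintro X S T ⟨hSX, hS, -⟩ ⟨hTX, hT, hTmax⟩
  rcases le_or_gt (S.image d).card (T.image d).card with hle | hlt
  · calc S.card ≤ k * (S.image d).card :=
          Finset.card_le_mul_card_image S k fun a _ => hS.2 a
      _ ≤ k * T.card := Nat.mul_le_mul_left k (hle.trans Finset.card_image_le)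
  · have fiber_le (a : D) :
        (S.filter fun s => d s = a).card ≤ (T.filter fun s => d s = a).card := by
      by_contra! h
      obtain ⟨x, hxa, hxT⟩ := Finset.exists_mem_notMem_of_card_lt_card h
      obtain ⟨hxS, rfl⟩ := Finset.mem_filter.mp hxa
      have hx : x ∉ T := fun hx => hxT (Finset.mem_filter.mpr ⟨hx, rfl⟩)
      have hins := hT.insert (hlt.trans_le hS.1) (h.trans_le (hS.2 _))
      exact hx (Finset.insert_eq_self.mp (hTmax _
        (Finset.insert_subset (hSX hxS) hTX) hins (Finset.subset_insert x T)))
    have hST : S.card ≤ T.card := by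
      rw [Finset.card_eq_sum_card_fiberwise (f := d) (t := (S ∪ T).image d)
          fun s hs => Finset.mem_image_of_mem d (Finset.mem_union_left T hs),
        Finset.card_eq_sum_card_fiberwise (f := d) (t := (S ∪ T).image d)
          fun s hs => Finset.mem_image_of_mem d (Finset.mem_union_right S hs)]
      exact Finset.sum_le_sum fun a _ => fiber_le a
    exact hST.trans (Nat.le_mul_of_pos_left _ hk)
end
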